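/- arXiv:2305.07976 — 2 statements merged into one kernel-verified Lean document; each statement's English description precedes it below -/
import Mathlib

section
/- Let Y be a real m×n matrix, Ω a set of index pairs, C > 0, λ > 0, and Θ an m×m real positive definite matrix. For every real m×n matrix W with all entries nonnegative, every real m×n matrix Z supported on Ω, and every real m×n matrix S with all entries nonnegative, weak duality holds: ⟨Z, Y_Ω⟩ − ‖Z‖²/(4C) − (λ/2) tr((Z+S)ᵀ Θ (Z+S)) ≤ C‖W_Ω − Y_Ω‖² + (1/(2λ)) tr(Wᵀ Θ⁻¹ W). -/
open Matrix

open scoped Classical in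
/-- The restriction `A_Ω` of a matrix to an index set `Ω`: entries outside `Ω` are set to `0`. -/
noncomputable def restrictM {m n : ℕ} (Ω : Set (Fin m × Fin n))
    (A : Matrix (Fin m) (Fin n) ℝ) : Matrix (Fin m) (Fin n) ℝ :=
  Matrix.of fun i j => if (i, j) ∈ Ω then A i j else 0

/-- A matrix supported on `Ω` pairs with `A` only through the restriction of `A` to `Ω`. -/
lemma trace_transpose_mul_restrictM {m n : ℕ} {Ω : Set (Fin m × Fin n)}
    {Z : Matrix (Fin m) (Fin n) ℝ} (hZ : restrictM Ω Z = Z) (A : Matrix (Fin m) (Fin n) ℝ) :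
    (Zᵀ * restrictM Ω A).trace = (Zᵀ * A).trace := by
  rw [← hZ]
  simp only [trace, diag_apply, mul_apply, transpose_apply, restrictM, of_apply]
  refine Finset.sum_congr rfl fun j _ => Finset.sum_congr rfl fun i _ => ?_
  split_ifs <;> simp

lemma trace_transpose_mul_comm {ι κ : Type*} [Fintype ι] [Fintype κ] (A B : Matrix ι κ ℝ) :
    (Aᵀ * B).trace = (Bᵀ * A).trace := by
  rw [← trace_transpose, transpose_mul, transpose_transpose]

lemma trace_transpose_mul_nonneg {ι κ : Type*} [Fintype ι] [Fintype κ] {A B : Matrix ι κ ℝ}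
    (hA : ∀ i j, 0 ≤ A i j) (hB : ∀ i j, 0 ≤ B i j) : 0 ≤ (Aᵀ * B).trace :=
  Finset.sum_nonneg fun j _ => Finset.sum_nonneg fun i _ => mul_nonneg (hA i j) (hB i j)

/-- Young's inequality for the Frobenius inner product, weighted by a positive definite matrix. -/
lemma Matrix.PosDef.two_mul_trace_transpose_mul_le {ι κ : Type*} [Fintype ι] [DecidableEq ι]
    [Fintype κ] {Θ : Matrix ι ι ℝ} (hΘ : Θ.PosDef) (l : ℝ) (A W : Matrix ι κ ℝ) :
    2 * l * (Aᵀ * W).trace ≤ l ^ 2 * (Aᵀ * Θ * A).trace + (Wᵀ * Θ⁻¹ * W).trace := by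
  have hdet : IsUnit Θ.det := hΘ.det_pos.ne'.isUnit
  have hsymm : Θᵀ = Θ := by simpa using hΘ.isHermitian.eq
  have h := (hΘ.inv.posSemidef.conjTranspose_mul_mul_same (l • (Θ * A) - W)).trace_nonneg
  have hexp : (l • (Θ * A) - W)ᴴ * Θ⁻¹ * (l • (Θ * A) - W) =
      l ^ 2 • (Aᵀ * Θ * A) - l • (Aᵀ * W) - l • (Wᵀ * A) + Wᵀ * Θ⁻¹ * W := by
    have h₁ : Aᵀ * Θ * Θ⁻¹ = Aᵀ := mul_nonsing_inv_cancel_right _ _ hdet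
    have h₂ : Wᵀ * Θ⁻¹ * Θ = Wᵀ := nonsing_inv_mul_cancel_right _ _ hdet
    rw [conjTranspose_eq_transpose_of_trivial, transpose_sub, transpose_smul, transpose_mul, hsymm]
    simp only [Matrix.sub_mul, Matrix.mul_sub, Matrix.smul_mul, Matrix.mul_smul, h₁, h₂, smul_smul,
      ← Matrix.mul_assoc, smul_sub, pow_two]
    abel
  rw [hexp, trace_add, trace_sub, trace_sub, trace_smul, trace_smul, trace_smul,
    trace_transpose_mul_comm W A] at h
  simp only [smul_eq_mul] at h
  linarith

/-- weak duality: for every entrywise-nonnegative `W`, every `Z` supported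
on `Ω` and every entrywise-nonnegative `S`,
`⟨Z, Y_Ω⟩ − ‖Z‖²/(4C) − (λ/2) tr((Z+S)ᵀ Θ (Z+S)) ≤ C‖W_Ω − Y_Ω‖² + (1/(2λ)) tr(Wᵀ Θ⁻¹ W)`. -/
theorem weak_duality {m n : ℕ} (Y : Matrix (Fin m) (Fin n) ℝ)
    (Ω : Set (Fin m × Fin n)) (C : ℝ) (hC : 0 < C) (l : ℝ) (hl : 0 < l)
    (Θ : Matrix (Fin m) (Fin m) ℝ) (hΘ : Θ.PosDef)
    (W : Matrix (Fin m) (Fin n) ℝ) (hW : ∀ i j, 0 ≤ W i j)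
    (Z : Matrix (Fin m) (Fin n) ℝ) (hZ : restrictM Ω Z = Z)
    (S : Matrix (Fin m) (Fin n) ℝ) (hS : ∀ i j, 0 ≤ S i j) :
    (Zᵀ * restrictM Ω Y).trace - (Zᵀ * Z).trace / (4 * C)
        - (l / 2) * ((Z + S)ᵀ * Θ * (Z + S)).trace ≤
      C * ((restrictM Ω W - restrictM Ω Y)ᵀ * (restrictM Ω W - restrictM Ω Y)).trace
        + (1 / (2 * l)) * (Wᵀ * Θ⁻¹ * W).trace := by
  have hquad := hΘ.two_mul_trace_transpose_mul_le l (Z + S) W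
  have hSW := trace_transpose_mul_nonneg hS hW
  have hZW := trace_transpose_mul_restrictM hZ W
  have hfit := Matrix.PosDef.one.two_mul_trace_transpose_mul_le (-(2 * C))
    (restrictM Ω W - restrictM Ω Y) Z
  rw [transpose_add, Matrix.add_mul, trace_add, ← transpose_add] at hquad
  rw [trace_transpose_mul_comm _ Z, Matrix.mul_sub, trace_sub, inv_one, Matrix.mul_one,
    Matrix.mul_one] at hfit
  generalize ((Z + S)ᵀ * Θ * (Z + S)).trace = a at *
  generalize (Wᵀ * Θ⁻¹ * W).trace = b at *
  generalize ((restrictM Ω W - restrictM Ω Y)ᵀ * (restrictM Ω W - restrictM Ω Y)).trace = d at *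
  have hquad' : (Zᵀ * W).trace + (Sᵀ * W).trace ≤ l / 2 * a + 1 / (2 * l) * b := by
    have : l / 2 * a + 1 / (2 * l) * b = (l ^ 2 * a + b) / (2 * l) := by field_simp
    rw [this, le_div_iff₀ (by positivity)]
    linarith
  have hfit' : (Zᵀ * restrictM Ω Y).trace - (Zᵀ * restrictM Ω W).trace ≤
      C * d + (Zᵀ * Z).trace / (4 * C) := by
    have : C * d + (Zᵀ * Z).trace / (4 * C) =
        ((-(2 * C)) ^ 2 * d + (Zᵀ * Z).trace) / (4 * C) := by field_simp; ring
    rw [this, le_div_iff₀ (by positivity)]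
    linarith
  linarith
end

section
/- Let Y be a real m×n matrix, Ω a set of index pairs, C > 0, λ > 0, and Θ an m×m real positive definite matrix. The function (Z, S) ↦ ⟨Z, Y_Ω⟩ − ‖Z‖²/(4C) − (λ/2) tr((Z+S)ᵀ Θ (Z+S)) is strictly concave on pairs of real m×n matrices: for all distinct pairs (Z₁,S₁) ≠ (Z₂,S₂) and all t ∈ (0,1), the value at (t Z₁ + (1−t) Z₂, t S₁ + (1−t) S₂) is strictly greater than t times the value at (Z₁,S₁) plus (1−t) times the value at (Z₂,S₂). -/
open Matrix

theorem Matrix.trace_quadratic_convexCombination {m n : ℕ} (Θ : Matrix (Fin m) (Fin m) ℝ)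
    (A B : Matrix (Fin m) (Fin n) ℝ) (t : ℝ) :
    ((t • A + (1 - t) • B)ᵀ * Θ * (t • A + (1 - t) • B)).trace =
      t * (Aᵀ * Θ * A).trace + (1 - t) * (Bᵀ * Θ * B).trace
        - t * (1 - t) * ((A - B)ᵀ * Θ * (A - B)).trace := by
  simp only [transpose_add, transpose_sub, transpose_smul, Matrix.add_mul, Matrix.mul_add,
    Matrix.sub_mul, Matrix.mul_sub, Matrix.smul_mul, Matrix.mul_smul, trace_add, trace_sub,
    trace_smul, smul_eq_mul]
  ring

theorem Matrix.PosDef.trace_transpose_mul_mul_nonneg {m n : ℕ} {Θ : Matrix (Fin m) (Fin m) ℝ}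
    (hΘ : Θ.PosDef) (A : Matrix (Fin m) (Fin n) ℝ) : 0 ≤ (Aᵀ * Θ * A).trace := by
  simpa using (hΘ.posSemidef.conjTranspose_mul_mul_same A).trace_nonneg

theorem Matrix.PosDef.trace_transpose_mul_mul_pos {m n : ℕ} {Θ : Matrix (Fin m) (Fin m) ℝ}
    (hΘ : Θ.PosDef) {A : Matrix (Fin m) (Fin n) ℝ} (hA : A ≠ 0) : 0 < (Aᵀ * Θ * A).trace := by
  have h_diag (j : Fin n) : (Aᵀ * Θ * A) j j = star (A.col j) ⬝ᵥ (Θ *ᵥ A.col j) := by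
    rw [Matrix.mul_assoc]
    rfl
  obtain ⟨j, hj⟩ : ∃ j, A.col j ≠ 0 := by
    by_contra! h
    exact hA (Matrix.ext fun i j => congrFun (h j) i)
  refine Finset.sum_pos' (fun k _ => ?_) ⟨j, Finset.mem_univ j, ?_⟩
  · rw [diag_apply, h_diag]
    exact hΘ.posSemidef.dotProduct_mulVec_nonneg _
  · rw [diag_apply, h_diag]
    exact hΘ.dotProduct_mulVec_pos hj

/-- the dual objective
`(Z, S) ↦ ⟨Z, Y_Ω⟩ − ‖Z‖²/(4C) − (λ/2) tr((Z+S)ᵀ Θ (Z+S))` is strictly concave on pairs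
of real m×n matrices: for distinct pairs and `t ∈ (0,1)`, its value at the convex
combination is strictly greater than the convex combination of its values. -/
theorem dual_strictly_concave {m n : ℕ} (Y : Matrix (Fin m) (Fin n) ℝ)
    (Ω : Set (Fin m × Fin n)) (C : ℝ) (hC : 0 < C) (l : ℝ) (hl : 0 < l)
    (Θ : Matrix (Fin m) (Fin m) ℝ) (hΘ : Θ.PosDef) :
    ∀ Z₁ S₁ Z₂ S₂ : Matrix (Fin m) (Fin n) ℝ, (Z₁, S₁) ≠ (Z₂, S₂) →
      ∀ t : ℝ, 0 < t → t < 1 →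
        t * ((Z₁ᵀ * restrictM Ω Y).trace - (Z₁ᵀ * Z₁).trace / (4 * C)
              - (l / 2) * ((Z₁ + S₁)ᵀ * Θ * (Z₁ + S₁)).trace)
          + (1 - t) * ((Z₂ᵀ * restrictM Ω Y).trace - (Z₂ᵀ * Z₂).trace / (4 * C)
              - (l / 2) * ((Z₂ + S₂)ᵀ * Θ * (Z₂ + S₂)).trace) <
        ((t • Z₁ + (1 - t) • Z₂)ᵀ * restrictM Ω Y).trace
          - ((t • Z₁ + (1 - t) • Z₂)ᵀ * (t • Z₁ + (1 - t) • Z₂)).trace / (4 * C)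
          - (l / 2) * (((t • Z₁ + (1 - t) • Z₂) + (t • S₁ + (1 - t) • S₂))ᵀ * Θ
              * ((t • Z₁ + (1 - t) • Z₂) + (t • S₁ + (1 - t) • S₂))).trace := by
  intro Z₁ S₁ Z₂ S₂ hne t ht0 ht1
  have h_sum : t • Z₁ + (1 - t) • Z₂ + (t • S₁ + (1 - t) • S₂) =
      t • (Z₁ + S₁) + (1 - t) • (Z₂ + S₂) := by
    module
  have h_norm := trace_quadratic_convexCombination 1 Z₁ Z₂ t
  simp only [Matrix.mul_one] at h_norm
  have h_lin : ((t • Z₁ + (1 - t) • Z₂)ᵀ * restrictM Ω Y).trace =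
      t * (Z₁ᵀ * restrictM Ω Y).trace + (1 - t) * (Z₂ᵀ * restrictM Ω Y).trace := by
    simp [Matrix.add_mul]
  rw [h_sum, trace_quadratic_convexCombination, h_norm, h_lin]
  have h_gap : 0 < ((Z₁ - Z₂)ᵀ * (Z₁ - Z₂)).trace / (4 * C) +
      l / 2 * ((Z₁ + S₁ - (Z₂ + S₂))ᵀ * Θ * (Z₁ + S₁ - (Z₂ + S₂))).trace := by
    by_cases hZ : Z₁ = Z₂
    · have hS : Z₁ + S₁ - (Z₂ + S₂) ≠ 0 := by
        subst hZ
        simpa [sub_eq_zero] using hne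
      have h_pos := hΘ.trace_transpose_mul_mul_pos hS
      simp only [hZ, sub_self, Matrix.mul_zero, trace_zero, zero_div, zero_add] at h_pos ⊢
      positivity
    · have h_pos := (PosDef.one (n := Fin m) (R := ℝ)).trace_transpose_mul_mul_pos
        (sub_ne_zero.mpr hZ)
      rw [Matrix.mul_one] at h_pos
      have h_nonneg := hΘ.trace_transpose_mul_mul_nonneg (Z₁ + S₁ - (Z₂ + S₂))
      positivity
  have h_scaled := mul_pos (mul_pos ht0 (sub_pos.mpr ht1)) h_gap
  rw [← sub_pos]
  refine h_scaled.trans_eq ?_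
  ring
end
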